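/- Fix an integer d ≥ 2 and let K be a perfect and infinite field. Then for every closed subset X of T^d with X ⊊ T^d, there exists an N ∈ ℕ such that for all d-tuples (V_1,…,V_d) of finite-dimensional K-vector spaces, every element of X(V_1,…,V_d) has strength at most N. -/

import Mathlib

noncomputable section

/-- A function `F : M → K` on a `K`-vector space `M` is a *polynomial function* if it lies in
the `K`-subalgebra of `M → K` generated by the linear functionals on `M`. -/
def IsPolyFun (K : Type) [Field K] {M : Type} [AddCommGroup M] [Module K M]
    (F : M → K) : Prop :=
  F ∈ Algebra.adjoin K (Set.range fun l : M →ₗ[K] K => (l : M → K))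

/-- A subset of a finite-dimensional `K`-vector space `M` is *Zariski closed* if it is the
common zero locus of a collection of polynomial functions on `M`. -/
def IsZariskiClosed (K : Type) [Field K] {M : Type} [AddCommGroup M] [Module K M]
    (C : Set M) : Prop :=
  ∃ S : Set (M → K), (∀ F ∈ S, IsPolyFun K F) ∧ C = {x | ∀ F ∈ S, F x = 0}

/-- We identify `T^d(K^{n 0}, …, K^{n (d-1)}) = K^{n 0} ⊗ ⋯ ⊗ K^{n (d-1)}` with the space of
`d`-way arrays `(∀ j, Fin (n j)) → K`.  A tensor `q` admits a strength decomposition with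
exactly `k` terms if `q = r 0 ⊗ s 0 + ⋯ + r (k-1) ⊗ s (k-1)` where `r i ∈ ⊗_{j ∈ J i} V_j`
and `s i ∈ ⊗_{j ∉ J i} V_j` for non-empty proper subsets `J i ⊊ {0, …, d-1}`. -/
def TensorDecomp (K : Type) [Field K] {d : ℕ} {n : Fin d → ℕ}
    (q : (∀ j, Fin (n j)) → K) (k : ℕ) : Prop :=
  ∃ (J : Fin k → Set (Fin d))
    (r : ∀ i, (∀ j : (J i), Fin (n j)) → K)
    (s : ∀ i, (∀ j : ↥(J i)ᶜ, Fin (n j)) → K),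
    (∀ i, (J i).Nonempty) ∧ (∀ i, J i ≠ Set.univ) ∧
    ∀ a : ∀ j, Fin (n j), q a = ∑ i, r i (fun j => a j) * s i (fun j => a j)

/-- The strength of the tensor `q` is at most `N`. -/
def TensorStrengthLe (K : Type) [Field K] {d : ℕ} {n : Fin d → ℕ}
    (q : (∀ j, Fin (n j)) → K) (N : ℕ) : Prop :=
  ∃ k ≤ N, TensorDecomp K q k

/-- The map `φ_0 ⊗ ⋯ ⊗ φ_{d-1} : T^d(K^{n 0}, …) → T^d(K^{m 0}, …)` induced by a `d`-tuple of
linear maps `φ_j : K^{n j} → K^{m j}` given by the matrices `A j`, in array coordinates. -/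
def tensorMap (K : Type) [Field K] {d : ℕ} {n m : Fin d → ℕ}
    (A : ∀ j, Matrix (Fin (m j)) (Fin (n j)) K) (q : (∀ j, Fin (n j)) → K) :
    (∀ j, Fin (m j)) → K :=
  fun b => ∑ a : ∀ j, Fin (n j), (∏ j, A j (b j) (a j)) * q a

/-- A closed subset `X` of the functor `T^d` over `K`: a rule assigning to each `d`-tuple
`(n 0, …, n (d-1))` (that is, to the tuple of vector spaces `K^{n j}`) a subset
`X(n) ⊆ T^d(K^{n 0}, …, K^{n (d-1)})` which is Zariski closed, and such that every `d`-tuple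
of linear maps `φ_j : K^{n j} → K^{m j}` maps `X(n)` into `X(m)` via `φ_0 ⊗ ⋯ ⊗ φ_{d-1}`. -/
structure ClosedSubsetTd (K : Type) [Field K] (d : ℕ) where
  carrier : ∀ n : Fin d → ℕ, Set ((∀ j, Fin (n j)) → K)
  closed : ∀ n, IsZariskiClosed K (carrier n)
  map_mem : ∀ {n m : Fin d → ℕ} (A : ∀ j, Matrix (Fin (m j)) (Fin (n j)) K),
    ∀ q ∈ carrier n, tensorMap K A q ∈ carrier m

section Strength

variable {K : Type} [Field K] {d : ℕ} {n : Fin d → ℕ}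

/-- A tensor that factors along a non-trivial bipartition of the set of tensor factors. -/
def IsSplitTensor (K : Type) [Field K] {d : ℕ} {n : Fin d → ℕ}
    (t : (∀ j, Fin (n j)) → K) : Prop :=
  ∃ J : Set (Fin d), J.Nonempty ∧ J ≠ Set.univ ∧
    ∃ (r : (∀ j : J, Fin (n j)) → K) (s : (∀ j : ↥Jᶜ, Fin (n j)) → K),
      ∀ a : ∀ j, Fin (n j), t a = r (fun j => a j) * s (fun j => a j)

theorem tensorDecomp_iff {q : (∀ j, Fin (n j)) → K} {k : ℕ} :
    TensorDecomp K q k ↔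
      ∃ t : Fin k → (∀ j, Fin (n j)) → K, (∀ i, IsSplitTensor K (t i)) ∧ q = ∑ i, t i := by
  constructor
  · rintro ⟨J, r, s, hJ, hJ', h⟩
    refine ⟨fun i a => r i (fun j => a j) * s i (fun j => a j),
      fun i => ⟨J i, hJ i, hJ' i, r i, s i, fun _ => rfl⟩, ?_⟩
    ext a
    simp [h a]
  · rintro ⟨t, ht, rfl⟩
    choose J hJ hJ' r s h using ht
    exact ⟨J, r, s, hJ, hJ', fun a => by simp [h]⟩

theorem TensorStrengthLe.mono {q : (∀ j, Fin (n j)) → K} {M N : ℕ} (h : TensorStrengthLe K q M)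
    (hMN : M ≤ N) : TensorStrengthLe K q N :=
  let ⟨k, hk, hq⟩ := h
  ⟨k, hk.trans hMN, hq⟩

theorem TensorStrengthLe.zero : TensorStrengthLe K (0 : (∀ j, Fin (n j)) → K) 0 :=
  ⟨0, le_rfl, tensorDecomp_iff.2 ⟨Fin.elim0, fun i => i.elim0, by simp⟩⟩

theorem TensorStrengthLe.add {q q' : (∀ j, Fin (n j)) → K} {M N : ℕ}
    (h : TensorStrengthLe K q M) (h' : TensorStrengthLe K q' N) :
    TensorStrengthLe K (q + q') (M + N) := by
  obtain ⟨k, hk, hq⟩ := h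
  obtain ⟨k', hk', hq'⟩ := h'
  obtain ⟨t, ht, rfl⟩ := tensorDecomp_iff.1 hq
  obtain ⟨t', ht', rfl⟩ := tensorDecomp_iff.1 hq'
  refine ⟨k + k', add_le_add hk hk', tensorDecomp_iff.2 ⟨Fin.append t t', ?_, ?_⟩⟩
  · intro i
    refine Fin.addCases (fun i => ?_) (fun i => ?_) i
    · simpa using ht i
    · simpa using ht' i
  · simp [Fin.sum_univ_add]

theorem IsSplitTensor.smul {t : (∀ j, Fin (n j)) → K} (ht : IsSplitTensor K t) (c : K) :
    IsSplitTensor K (c • t) := by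
  obtain ⟨J, hJ, hJ', r, s, h⟩ := ht
  exact ⟨J, hJ, hJ', c • r, s, fun a => by simp [h a, mul_assoc]⟩

theorem TensorStrengthLe.smul {q : (∀ j, Fin (n j)) → K} {N : ℕ}
    (h : TensorStrengthLe K q N) (c : K) : TensorStrengthLe K (c • q) N := by
  obtain ⟨k, hk, hq⟩ := h
  obtain ⟨t, ht, rfl⟩ := tensorDecomp_iff.1 hq
  exact ⟨k, hk, tensorDecomp_iff.2 ⟨fun i => c • t i, fun i => (ht i).smul c, Finset.smul_sum⟩⟩

theorem IsSplitTensor.strengthLe_one {t : (∀ j, Fin (n j)) → K} (ht : IsSplitTensor K t) :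
    TensorStrengthLe K t 1 :=
  ⟨1, le_rfl, tensorDecomp_iff.2 ⟨fun _ => t, fun _ => ht, by simp⟩⟩

theorem TensorStrengthLe.sum {ι : Type*} (s : Finset ι) (t : ι → (∀ j, Fin (n j)) → K)
    (ht : ∀ i ∈ s, IsSplitTensor K (t i)) : TensorStrengthLe K (∑ i ∈ s, t i) s.card := by
  classical
  induction s using Finset.induction_on with
  | empty => simpa using TensorStrengthLe.zero
  | insert i s hi ih =>
    rw [Finset.sum_insert hi, Finset.card_insert_of_notMem hi, add_comm s.card]
    exact (ht i (Finset.mem_insert_self i s)).strengthLe_one.add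
      (ih fun j hj => ht j (Finset.mem_insert_of_mem hj))

/-- A function of tuples whose value depends only on the entries in `J` factors through the
restriction to `J`. -/
theorem exists_eq_restrict {J : Set (Fin d)} {F : (∀ j, Fin (n j)) → K}
    (hF : ∀ a a', (∀ j ∈ J, a j = a' j) → F a = F a') :
    ∃ r : (∀ j : J, Fin (n j)) → K, ∀ a, F a = r (fun j => a j) := by
  classical
  refine ⟨fun y => if h : ∃ a : ∀ j, Fin (n j), (fun j : J => a j) = y then F h.choose else 0,
    fun a => ?_⟩
  have h : ∃ a' : ∀ j, Fin (n j), (fun j : J => a' j) = fun j : J => a j := ⟨a, rfl⟩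
  simp only [dif_pos h]
  exact hF _ _ fun j hj => (congrFun h.choose_spec ⟨j, hj⟩).symm

theorem isSplitTensor_mul {J : Set (Fin d)} (hJ : J.Nonempty) (hJ' : J ≠ Set.univ)
    {F G : (∀ j, Fin (n j)) → K} (hF : ∀ a a', (∀ j ∈ J, a j = a' j) → F a = F a')
    (hG : ∀ a a', (∀ j ∈ Jᶜ, a j = a' j) → G a = G a') :
    IsSplitTensor K (F * G) := by
  obtain ⟨r, hr⟩ := exists_eq_restrict hF
  obtain ⟨s, hs⟩ := exists_eq_restrict hG
  exact ⟨J, hJ, hJ', r, s, fun a => by rw [Pi.mul_apply, hr, hs]⟩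

end Strength

section Multilinear

open MvPolynomial

/-- Families of polynomials in `t_0, …, t_{d-1}`, indexed by tuples `a`, whose coefficient at each
monomial depends only on the entries of `a` at the variables occurring in that monomial. -/
def localFamilies (K : Type) [Field K] {d : ℕ} (n : Fin d → ℕ) :
    Subalgebra K ((∀ j, Fin (n j)) → MvPolynomial (Fin d) K) where
  carrier := {P | ∀ (u : Fin d →₀ ℕ) (a a' : ∀ j, Fin (n j)),
    (∀ j, u j ≠ 0 → a j = a' j) → coeff u (P a) = coeff u (P a')}
  add_mem' {P Q} hP hQ u a a' h := by
    simp [hP u a a' h, hQ u a a' h]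
  mul_mem' {P Q} hP hQ u a a' h := by
    classical
    simp only [Pi.mul_apply, coeff_mul]
    refine Finset.sum_congr rfl fun x hx => ?_
    rw [Finset.HasAntidiagonal.mem_antidiagonal] at hx
    subst hx
    rw [hP x.1 a a' fun j hj => h j (by simp [hj]), hQ x.2 a a' fun j hj => h j (by simp [hj])]
  algebraMap_mem' _ _ _ _ _ := rfl

/-- The exponent vector of `t_0 ⋯ t_{d-1}`. -/
def onesExponent (d : ℕ) : Fin d →₀ ℕ := Finsupp.equivFunOnFinite.symm fun _ => 1

@[simp] theorem onesExponent_apply {d : ℕ} (j : Fin d) : onesExponent d j = 1 := rfl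

theorem onesExponent_ne_zero {d : ℕ} (hd : d ≠ 0) : onesExponent d ≠ 0 := fun h => by
  simpa using DFunLike.congr_fun h (⟨0, Nat.pos_of_ne_zero hd⟩ : Fin d)

theorem isSplitTensor_coeff_mul {K : Type} [Field K] {d : ℕ} {n : Fin d → ℕ}
    {P Q : (∀ j, Fin (n j)) → MvPolynomial (Fin d) K} (hP : P ∈ localFamilies K n)
    (hQ : Q ∈ localFamilies K n) {u v : Fin d →₀ ℕ} (huv : u + v = onesExponent d)
    (hu : u ≠ 0) (hv : v ≠ 0) :
    IsSplitTensor K (fun a => coeff u (P a) * coeff v (Q a)) := by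
  have hj (j) : u j + v j = 1 := by simpa using DFunLike.congr_fun huv j
  refine isSplitTensor_mul (J := {j | u j ≠ 0}) ?_ ?_ (hP u) fun a a' h =>
    hQ v a a' fun j hvj => h j ?_
  · obtain ⟨j, hj⟩ := DFunLike.ne_iff.1 hu
    exact ⟨j, hj⟩
  · intro h
    obtain ⟨j, hvj⟩ := DFunLike.ne_iff.1 hv
    have huj : j ∈ {j | u j ≠ 0} := h ▸ Set.mem_univ j
    have := hj j
    simp only [Finsupp.coe_zero, Pi.zero_apply, Set.mem_ofPred_eq] at hvj huj
    omega
  · have := hj j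
    simp only [Set.mem_compl_iff, Set.mem_ofPred_eq]
    omega

theorem exists_strengthLe_coeff_mul (d : ℕ) (hd : d ≠ 0) :
    ∃ N, ∀ (K : Type) [Field K] (n : Fin d → ℕ), ∀ P ∈ localFamilies K n,
      ∀ Q ∈ localFamilies K n, TensorStrengthLe K (fun a => coeff (onesExponent d) (P a * Q a) -
        (coeff 0 (P a) * coeff (onesExponent d) (Q a) +
          coeff (onesExponent d) (P a) * coeff 0 (Q a))) N := by
  classical
  set e := onesExponent d
  set s := ((Finset.HasAntidiagonal.antidiagonal e).erase (0, e)).erase (e, 0)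
  refine ⟨s.card, fun K _ n P hP Q hQ => ?_⟩
  have he : e ≠ 0 := onesExponent_ne_zero hd
  have := TensorStrengthLe.sum s (fun x a => coeff x.1 (P a) * coeff x.2 (Q a)) fun x hx => by
    simp only [s, Finset.mem_erase, Finset.HasAntidiagonal.mem_antidiagonal, ne_eq] at hx
    obtain ⟨h1, h2, h3⟩ := hx
    refine isSplitTensor_coeff_mul hP hQ h3 ?_ ?_
    · intro h
      exact h2 (Prod.ext h (by simpa [h] using h3))
    · intro h
      exact h1 (Prod.ext (by simpa [h] using h3) h)
  convert this using 1
  ext a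
  rw [Finset.sum_apply, coeff_mul,
    ← Finset.add_sum_erase _ _ (a := ((0 : Fin d →₀ ℕ), e)) (by simp),
    ← Finset.add_sum_erase _ _ (a := (e, (0 : Fin d →₀ ℕ))) (by simp [he])]
  ring

theorem map_aeval_eq_eval {R σ τ : Type*} [CommSemiring R] (φ : MvPolynomial τ R →+* R)
    (hφ : ∀ c, φ (C c) = c) (x : σ → MvPolynomial τ R) (f : MvPolynomial σ R) :
    φ (aeval x f) = eval (fun b => φ (x b)) f := by
  induction f using MvPolynomial.induction_on with
  | C c => simp [algebraMap_eq, hφ]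
  | add f g hf hg => simp only [map_add, hf, hg]
  | mul_X f b hf => simp only [map_mul, hf, aeval_X, eval_X]

/-- Up to a tensor of bounded strength, the multilinear coefficient of `f (x a)` is given by the
linear part of `f`. -/
theorem exists_strengthLe_coeff_aeval {K : Type} [Field K] {d : ℕ} (hd : d ≠ 0) {σ : Type}
    (i : σ) (f : MvPolynomial σ K) :
    ∃ N, ∀ (n : Fin d → ℕ) (q : (∀ j, Fin (n j)) → K) (x₀ : σ → K)
      (x : σ → (∀ j, Fin (n j)) → MvPolynomial (Fin d) K), (∀ b, x b ∈ localFamilies K n) →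
      (∀ b a, coeff 0 (x b a) = x₀ b) → (∀ a, coeff (onesExponent d) (x i a) = q a) →
      (∀ b a, b ≠ i → coeff (onesExponent d) (x b a) = 0) →
      TensorStrengthLe K (fun a => coeff (onesExponent d) (aeval (fun b => x b a) f) -
        eval x₀ (pderiv i f) * q a) N := by
  classical
  have he := onesExponent_ne_zero hd
  induction f using MvPolynomial.induction_on with
  | C c =>
    refine ⟨0, fun n q x₀ x _ _ _ _ => ?_⟩
    convert TensorStrengthLe.zero using 1
    ext a
    simp [algebraMap_eq, coeff_C, he.symm]
  | add f g hf hg =>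
    obtain ⟨M, hM⟩ := hf
    obtain ⟨N, hN⟩ := hg
    refine ⟨M + N, fun n q x₀ x h1 h2 h3 h4 => ?_⟩
    convert (hM n q x₀ x h1 h2 h3 h4).add (hN n q x₀ x h1 h2 h3 h4) using 1
    ext a
    simp only [map_add, coeff_add, Pi.add_apply]
    ring
  | mul_X f b hf =>
    obtain ⟨M, hM⟩ := hf
    obtain ⟨N, hN⟩ := exists_strengthLe_coeff_mul d hd
    refine ⟨M + N, fun n q x₀ x h1 h2 h3 h4 => ?_⟩
    have hmem : (fun a => aeval (fun b => x b a) f) ∈ localFamilies K n := by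
      have : (fun a => aeval (fun b => x b a) f) = aeval x f := by
        ext1 a
        exact (comp_aeval_apply x (Pi.evalAlgHom K _ a) f).symm
      rw [this]
      exact Subalgebra.mvPolynomial_aeval_coe _ (fun b => ⟨x b, h1 b⟩) f ▸ SetLike.coe_mem _
    have h0 (a) : coeff 0 (aeval (fun b => x b a) f) = eval x₀ f := by
      rw [← constantCoeff_eq, map_aeval_eq_eval _ (constantCoeff_C _)]
      simp only [constantCoeff_eq, h2]
    convert ((hM n q x₀ x h1 h2 h3 h4).smul (x₀ b)).add (hN K n _ hmem (x b) (h1 b)) using 1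
    ext a
    have hb : coeff (onesExponent d) (x b a) = if b = i then q a else 0 := by
      split_ifs with h
      · rw [h, h3]
      · exact h4 b a h
    simp only [Pi.add_apply, Pi.smul_apply, smul_eq_mul, map_mul, aeval_X, pderiv_mul, map_add,
      eval_X, h0, h2, hb, pderiv_X, Pi.single_apply]
    split_ifs <;> simp <;> ring

end Multilinear

section PerfectField

open MvPolynomial

theorem totalDegree_pderiv_lt {R σ : Type*} [CommSemiring R] {f : MvPolynomial σ R}
    (hf : f.totalDegree ≠ 0) (i : σ) : (pderiv i f).totalDegree < f.totalDegree := by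
  rw [totalDegree, Finset.sup_lt_iff (Nat.pos_of_ne_zero hf)]
  intro s hs
  rw [mem_support_iff, coeff_pderiv] at hs
  have := le_totalDegree (mem_support_iff.2 (left_ne_zero_of_mul hs))
  rw [Finsupp.sum_add_index' (fun _ => rfl) (fun _ _ _ => rfl)] at this
  simp only [Finsupp.sum_single_index] at this
  omega

/-- Over a perfect field, a non-constant polynomial all of whose partial derivatives vanish is a
power of a polynomial of smaller degree. -/
theorem exists_pow_eq_of_pderiv_eq_zero {K : Type} [Field K] [PerfectField K] {σ : Type}
    {f : MvPolynomial σ K} (hf : f.totalDegree ≠ 0) (h : ∀ i, pderiv i f = 0) :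
    ∃ (g : MvPolynomial σ K) (p : ℕ), g ^ p = f ∧ g.totalDegree < f.totalDegree := by
  obtain ⟨p, hp⟩ := ExpChar.exists K
  have hdvd : ∀ s ∈ f.support, ∀ i, ((s i : ℕ) : K) = 0 := by
    intro s hs i
    by_contra hsi
    have hsi' : s i ≠ 0 := fun h0 => hsi (by simp [h0])
    have h1 := coeff_pderiv (i := i) f (s - Finsupp.single i 1 : σ →₀ ℕ)
    rw [h i, coeff_zero, tsub_add_cancel_of_le (by simpa [Nat.one_le_iff_ne_zero] using hsi')] at h1
    have h2 : (((s - Finsupp.single i 1 : σ →₀ ℕ) i : ℕ) : K) + 1 = s i := by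
      rw [← Nat.cast_succ]
      congr 1
      simp
      omega
    rw [h2] at h1
    exact (mul_ne_zero (mem_support_iff.1 hs) hsi) h1.symm
  cases hp with
  | zero =>
    exfalso
    apply hf
    rw [totalDegree_eq_zero_iff]
    intro s hs i
    exact_mod_cast hdvd s hs i
  | prime hp =>
    have := Fact.mk hp
    have : ExpChar K p := .prime hp
    set g : MvPolynomial σ K := ∑ s ∈ f.support, monomial (s.mapRange (· / p) (Nat.zero_div p))
      ((frobeniusEquiv K p).symm (coeff s f)) with hg
    have hgf : g ^ p = f := by
      rw [hg, sum_pow_char p]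
      conv_rhs => rw [f.as_sum]
      refine Finset.sum_congr rfl fun s hs => ?_
      rw [monomial_pow, frobeniusEquiv_symm_pow_p]
      refine congrArg (fun u => monomial u (coeff s f)) ?_
      exact Finsupp.ext fun i => by
        simpa using Nat.mul_div_cancel' ((CharP.cast_eq_zero_iff K p (s i)).1 (hdvd s hs i))
    refine ⟨g, p, hgf, ?_⟩
    have hg0 : g ≠ 0 := by
      intro h0
      rw [h0, zero_pow hp.ne_zero] at hgf
      exact hf (by simp [← hgf])
    have hgd : g.totalDegree ≠ 0 := fun h0 => hf <| by
      have := totalDegree_pow g p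
      rw [hgf, h0] at this
      omega
    obtain ⟨k, rfl⟩ := Nat.exists_eq_add_of_le' hp.two_le
    rw [← hgf, pow_succ, pow_succ, totalDegree_mul_of_isDomain (by positivity) hg0,
      totalDegree_mul_of_isDomain (by positivity) hg0]
    omega

end PerfectField

section Bound

open MvPolynomial

theorem coeff_onesExponent_prod {K : Type} [Field K] {d : ℕ} (α β : Fin d → K) :
    coeff (onesExponent d) (∏ j, (C (β j) * X j + C (α j))) = ∏ j, β j := by
  classical
  have key (J : Finset (Fin d)) : (∏ j ∈ J, C (β j) * X j) * ∏ j ∈ Jᶜ, C (α j) =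
      monomial (∑ j ∈ J, Finsupp.single j 1) ((∏ j ∈ J, β j) * ∏ j ∈ Jᶜ, α j) := by
    rw [Finset.prod_mul_distrib, ← map_prod, ← map_prod, mul_right_comm, ← C_mul,
      monomial_sum_index]
    rfl
  rw [Fintype.prod_add, coeff_sum, Finset.sum_eq_single Finset.univ]
  · have : ∑ j : Fin d, Finsupp.single j 1 = onesExponent d := by
      ext j
      simp [Finsupp.finsetSum_apply, Finsupp.single_apply]
    rw [key, this, coeff_monomial, if_pos rfl, Finset.compl_univ, Finset.prod_empty, mul_one]
  · intro J _ hJ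
    rw [key, coeff_monomial, if_neg]
    intro h
    refine hJ (Finset.eq_univ_iff_forall.2 fun j => ?_)
    by_contra hj
    have := DFunLike.congr_fun h j
    simp [Finsupp.finsetSum_apply, Finsupp.single_apply, hj] at this
  · simp

/-- Coordinates of the image of `q` under the maps `A_j + t_j e_{i_j} ⊗ e_{a_j}^*`, as polynomials
in the parameters `t_j`. -/
def perturbedCoord {K : Type} [Field K] {d : ℕ} {m n : Fin d → ℕ}
    (A : ∀ j, Matrix (Fin (m j)) (Fin (n j)) K) (q : (∀ j, Fin (n j)) → K)
    (i b : ∀ j, Fin (m j)) (a : ∀ j, Fin (n j)) : MvPolynomial (Fin d) K :=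
  ∑ c : ∀ j, Fin (n j),
    C (q c) * ∏ j, (C (if b j = i j ∧ c j = a j then 1 else 0) * X j + C (A j (b j) (c j)))

section PerturbedCoord

variable {K : Type} [Field K] {d : ℕ} {m n : Fin d → ℕ}
  (A : ∀ j, Matrix (Fin (m j)) (Fin (n j)) K) (q : (∀ j, Fin (n j)) → K)
  (i b : ∀ j, Fin (m j)) (a : ∀ j, Fin (n j))

theorem perturbedCoord_mem_localFamilies : perturbedCoord A q i b ∈ localFamilies K n := by
  have : perturbedCoord A q i b = ∑ c : ∀ j, Fin (n j),
      algebraMap K _ (q c) * ∏ j, ((fun a => C (if b j = i j ∧ c j = a j then 1 else 0) * X j) +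
        algebraMap K _ (A j (b j) (c j))) := by
    ext1 a
    simp [perturbedCoord, algebraMap_eq]
  rw [this]
  refine sum_mem fun c _ => mul_mem (algebraMap_mem _ _)
    (prod_mem fun j _ => add_mem ?_ (algebraMap_mem _ _))
  intro u a a' h
  simp only [coeff_C_mul, coeff_X]
  by_cases hu : Finsupp.single j 1 = u
  · rw [h j (by simp [← hu])]
  · simp [hu]

theorem coeff_zero_perturbedCoord : coeff 0 (perturbedCoord A q i b a) = tensorMap K A q b := by
  rw [← constantCoeff_eq]
  simp only [perturbedCoord, tensorMap, map_sum, map_mul, map_prod, map_add, constantCoeff_C,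
    constantCoeff_X, mul_zero, zero_add, mul_comm (q _)]

theorem coeff_onesExponent_perturbedCoord :
    coeff (onesExponent d) (perturbedCoord A q i b a) = if b = i then q a else 0 := by
  simp only [perturbedCoord, coeff_sum, coeff_C_mul, coeff_onesExponent_prod, Fintype.prod_boole,
    forall_and, ← _root_.funext_iff]
  by_cases hb : b = i <;> simp [hb]

theorem eval_perturbedCoord (t : Fin d → K) :
    eval t (perturbedCoord A q i b a) = tensorMap K
      (fun j => Matrix.of fun b' c => (if b' = i j ∧ c = a j then t j else 0) + A j b' c) q b := by
  simp only [perturbedCoord, tensorMap, map_sum, map_mul, map_prod, map_add, eval_C, eval_X,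
    ite_mul, one_mul, zero_mul, Matrix.of_apply, mul_comm (q _)]

end PerturbedCoord

/-- Tensors of `T^d V` all of whose images in `T^d U` are zeros of a fixed non-zero polynomial
have strength bounded independently of `V`. -/
theorem exists_strengthLe_of_eval_tensorMap_eq_zero {K : Type} [Field K] [PerfectField K]
    [Infinite K] {d : ℕ} (hd : d ≠ 0) {m : Fin d → ℕ}
    (f : MvPolynomial (∀ j, Fin (m j)) K) (hf : f ≠ 0) :
    ∃ N, ∀ (n : Fin d → ℕ) (q : (∀ j, Fin (n j)) → K),
      (∀ A : ∀ j, Matrix (Fin (m j)) (Fin (n j)) K, eval (tensorMap K A q) f = 0) →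
        TensorStrengthLe K q N := by
  induction hk : f.totalDegree using Nat.strong_induction_on generalizing f with
  | _ k ih =>
  subst hk
  by_cases hdeg : f.totalDegree = 0
  · refine ⟨0, fun n q h => absurd (h 0) ?_⟩
    rw [totalDegree_eq_zero_iff_eq_C] at hdeg
    rw [hdeg, eval_C]
    intro h0
    rw [h0, C_0] at hdeg
    exact hf hdeg
  by_cases hder : ∀ i, pderiv i f = 0
  · obtain ⟨g, p, hgf, hlt⟩ := exists_pow_eq_of_pderiv_eq_zero hdeg hder
    have hp : p ≠ 0 := by
      rintro rfl
      rw [← hgf] at hdeg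
      simp at hdeg
    obtain ⟨N, hN⟩ := ih _ hlt g (by rintro rfl; exact hf (by simp [← hgf, hp])) rfl
    refine ⟨N, fun n q h => hN n q fun A => ?_⟩
    have := h A
    rw [← hgf, map_pow] at this
    exact eq_zero_of_pow_eq_zero this
  push Not at hder
  obtain ⟨i, hi⟩ := hder
  obtain ⟨M, hM⟩ := ih _ (totalDegree_pderiv_lt hdeg i) (pderiv i f) hi rfl
  obtain ⟨N, hN⟩ := exists_strengthLe_coeff_aeval hd i f
  refine ⟨max M N, fun n q h => ?_⟩
  by_cases hA : ∀ A : ∀ j, Matrix (Fin (m j)) (Fin (n j)) K, eval (tensorMap K A q) (pderiv i f) = 0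
  · exact (hM n q hA).mono (le_max_left _ _)
  push Not at hA
  obtain ⟨A, hA⟩ := hA
  have key := hN n q (tensorMap K A q) (perturbedCoord A q i)
    (fun b => perturbedCoord_mem_localFamilies A q i b)
    (fun b a => coeff_zero_perturbedCoord A q i b a)
    (fun a => by simp [coeff_onesExponent_perturbedCoord])
    (fun b a hb => by simp [coeff_onesExponent_perturbedCoord, hb])
  have hzero (a) : aeval (fun b => perturbedCoord A q i b a) f = 0 := by
    refine MvPolynomial.funext fun t => ?_
    rw [map_zero, ← h fun j =>
      Matrix.of fun b' c => (if b' = i j ∧ c = a j then t j else 0) + A j b' c]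
    rw [map_aeval_eq_eval _ fun c => eval_C c]
    simp only [eval_perturbedCoord]
  have := (key.smul (-(eval (tensorMap K A q) (pderiv i f))⁻¹)).mono (le_max_right M N)
  convert this using 1
  ext a
  simp only [Pi.smul_apply, hzero, coeff_zero, zero_sub, smul_eq_mul]
  field_simp

end Bound

theorem IsPolyFun.exists_mvPolynomial {K : Type} [Field K] {ι : Type} [Finite ι] {F : (ι → K) → K}
    (hF : IsPolyFun K F) : ∃ f : MvPolynomial ι K, ∀ x, MvPolynomial.eval x f = F x := by
  classical
  have := Fintype.ofFinite ι
  induction hF using Algebra.adjoin_induction with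
  | mem F h =>
    obtain ⟨l, rfl⟩ := h
    refine ⟨∑ i, MvPolynomial.C (l (Pi.single i 1)) * MvPolynomial.X i, fun x => ?_⟩
    conv_rhs => rw [pi_eq_sum_univ' x]
    simp [mul_comm, Pi.single]
  | algebraMap c => exact ⟨MvPolynomial.C c, fun x => by simp⟩
  | add F G _ _ hF hG =>
    obtain ⟨f, hf⟩ := hF
    obtain ⟨g, hg⟩ := hG
    exact ⟨f + g, fun x => by simp [hf, hg]⟩
  | mul F G _ _ hF hG =>
    obtain ⟨f, hf⟩ := hF
    obtain ⟨g, hg⟩ := hG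
    exact ⟨f * g, fun x => by simp [hf, hg]⟩

/-- **Theorem (main theorem for ordinary tensors).** Fix `d ≥ 2` and let `K` be a perfect
infinite field. For every closed subset `X ⊊ T^d` there is an `N` such that for all
finite-dimensional vector spaces `V_1, …, V_d` (i.e. all tuples `K^{n j}`), all elements of
`X(V_1, …, V_d)` have strength at most `N`. -/
theorem strength_bounded_of_closed_proper_Td
    (K : Type) [Field K] [PerfectField K] [Infinite K]
    (d : ℕ) (hd : 2 ≤ d) (X : ClosedSubsetTd K d)
    (hX : ∃ n : Fin d → ℕ, X.carrier n ≠ Set.univ) :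
    ∃ N : ℕ, ∀ n : Fin d → ℕ, ∀ q ∈ X.carrier n, TensorStrengthLe K q N := by
  obtain ⟨m, hm⟩ := hX
  obtain ⟨S, hS, hXS⟩ := X.closed m
  obtain ⟨F, hF, x, hx⟩ : ∃ F ∈ S, ∃ x, F x ≠ 0 := by
    by_contra! h
    exact hm (hXS.trans (Set.eq_univ_iff_forall.2 fun x F hF => h F hF x))
  obtain ⟨f, hf⟩ := (hS F hF).exists_mvPolynomial
  obtain ⟨N, hN⟩ := exists_strengthLe_of_eval_tensorMap_eq_zero (by omega) f
    (by rintro rfl; exact hx (by simp [← hf]))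
  refine ⟨N, fun n q hq => hN n q fun A => ?_⟩
  have := X.map_mem A q hq
  rw [hXS] at this
  rw [hf]
  exact this F hF

end
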